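/- Let ψ be a waiting-time density with survival probability Φ(t) = ∫_t^∞ ψ(t') dt', let 0 < γ < 1 and κ, τ > 0, and suppose lim_{t→∞} t^{1+γ} ψ(t) = κ τ^γ. Then lim_{s→0+} s^{γ−1} · L{ψ}(s)/L{Φ}(s) = γ/(κ Γ(1−γ) τ^γ); that is, L{ψ}(s)/L{Φ}(s) ~ A_γ s^{1−γ}/τ^γ as s → 0+, where A_γ = γ/(κ Γ(1−γ)). -/

import Mathlib

open Real Set Filter MeasureTheory

lemma aux_tail (γ C : ℝ) (hγ0 : 0 < γ) 
    (ψ Φ : ℝ → ℝ)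
    (hψ_int : IntegrableOn ψ (Set.Ioi 0))
    (hΦ : ∀ t, Φ t = ∫ t' in Set.Ioi t, ψ t')
    (htail : Tendsto (fun t : ℝ => t ^ (1 + γ) * ψ t) atTop (nhds C)) :
    Tendsto (fun t : ℝ => t ^ γ * Φ t) atTop (nhds (C / γ)) := by
  have hlim : ∫ u in Ioi (1:ℝ), u ^ (-1 - γ) * C = C / γ := by
    rw [integral_mul_const, integral_Ioi_rpow_of_lt (by linarith) one_pos]
    have : -1 - γ + 1 = -γ := by ring
    rw [this, one_rpow]
    field_simp
  have hev : ∀ᶠ x in atTop, ‖x ^ (1 + γ) * ψ x‖ ≤ |C| + 1 := by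
    have := htail.norm.eventually (gt_mem_nhds (show ‖C‖ < |C| + 1 by rw [Real.norm_eq_abs]; linarith))
    filter_upwards [this] with x hx using hx.le
  obtain ⟨T, hT⟩ := eventually_atTop.1 hev
  rw [← hlim]
  have key : ∀ t : ℝ, 0 < t → 
      ∫ u in Ioi (1:ℝ), u ^ (-1 - γ) * ((t * u) ^ (1 + γ) * ψ (t * u)) = t ^ γ * Φ t := by
    intro t ht
    have e1 := integral_comp_mul_left_Ioi ψ 1 ht
    rw [mul_one, ← hΦ, smul_eq_mul] at e1
    have : t ^ γ * Φ t = t ^ (1 + γ) * (t⁻¹ * Φ t) := by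
      rw [rpow_add ht, rpow_one]; field_simp
    rw [this, ← e1, ← integral_const_mul]
    apply setIntegral_congr_fun measurableSet_Ioi
    intro u hu
    have hu : 0 < u := lt_trans one_pos hu
    simp only
    rw [mul_rpow ht.le hu.le, show -1 - γ = -(1 + γ) by ring, rpow_neg hu.le]
    have := (rpow_pos_of_pos hu (1 + γ)).ne'
    field_simp
  have main : Tendsto (fun t : ℝ => ∫ u in Ioi (1:ℝ), u ^ (-1 - γ) * ((t * u) ^ (1 + γ) * ψ (t * u)))
      atTop (nhds (∫ u in Ioi (1:ℝ), u ^ (-1 - γ) * C)) := by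
    apply tendsto_integral_filter_of_dominated_convergence (fun u => u ^ (-1 - γ) * (|C| + 1))
    · filter_upwards [eventually_gt_atTop 0] with t ht
      have hi : IntegrableOn (fun u => ψ (t * u)) (Ioi 1) := by
        rw [integrableOn_Ioi_comp_mul_left_iff _ _ ht]
        exact hψ_int.mono_set (Ioi_subset_Ioi (by simpa using ht.le))
      refine AEStronglyMeasurable.mul ?_ (AEStronglyMeasurable.mul ?_ hi.1)
      · exact (measurable_id.pow_const _).aestronglyMeasurable
      · exact ((measurable_id.const_mul t).pow_const _).aestronglyMeasurable
    · filter_upwards [eventually_ge_atTop T, eventually_ge_atTop 0] with t ht ht0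
      rw [ae_restrict_iff' measurableSet_Ioi]
      refine Eventually.of_forall fun u hu => ?_
      have hu : 1 < u := hu
      have h0 : 0 ≤ u ^ (-1 - γ) := rpow_nonneg (by linarith) _
      rw [norm_mul, Real.norm_of_nonneg h0]
      exact mul_le_mul_of_nonneg_left (hT _ (by nlinarith)) h0
    · exact (integrableOn_Ioi_rpow_of_lt (by linarith) one_pos).mul_const _
    · rw [ae_restrict_iff' measurableSet_Ioi]
      refine Eventually.of_forall fun u hu => ?_
      have hu : 1 < u := hu
      exact (htail.comp (tendsto_id.atTop_mul_const (by linarith))).const_mul _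
  refine main.congr' ?_
  filter_upwards [eventually_gt_atTop 0] with t ht using key t ht

lemma aux_lap (γ L : ℝ) (hγ0 : 0 < γ) (hγ1 : γ < 1) (Φ : ℝ → ℝ)
    (hanti : AntitoneOn Φ (Ioi 0)) (hb : ∀ t, 0 < t → ‖Φ t‖ ≤ 1)
    (h : Tendsto (fun t : ℝ => t ^ γ * Φ t) atTop (nhds L)) :
    Tendsto (fun s : ℝ => s ^ (1 - γ) * ∫ t in Ioi (0:ℝ), Real.exp (-s * t) * Φ t)
      (nhdsWithin 0 (Ioi 0)) (nhds (Real.Gamma (1 - γ) * L)) := by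
  have hev : ∀ᶠ x in atTop, ‖x ^ γ * Φ x‖ ≤ |L| + 1 := by
    have := h.norm.eventually (gt_mem_nhds (show ‖L‖ < |L| + 1 by rw [Real.norm_eq_abs]; linarith))
    filter_upwards [this] with x hx using hx.le
  obtain ⟨T, hT⟩ := eventually_atTop.1 hev
  obtain ⟨M, hM⟩ : ∃ M, ∀ x, 0 < x → ‖x ^ γ * Φ x‖ ≤ M := by
    refine ⟨max (|L| + 1) (T ^ γ), fun x hx => ?_⟩
    rcases le_total T x with h1 | h1
    · exact (hT x h1).trans (le_max_left _ _)
    · refine le_trans ?_ (le_max_right _ _)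
      have h0 : 0 ≤ x ^ γ := rpow_nonneg hx.le _
      rw [norm_mul, Real.norm_of_nonneg h0]
      calc x ^ γ * ‖Φ x‖ ≤ x ^ γ * 1 := mul_le_mul_of_nonneg_left (hb x hx) h0
        _ ≤ T ^ γ := by rw [mul_one]; exact rpow_le_rpow hx.le h1 hγ0.le
  have hgi : IntegrableOn (fun u : ℝ => Real.exp (-u) * u ^ (-γ)) (Ioi 0) := by
    have := Real.GammaIntegral_convergent (s := 1 - γ) (by linarith)
    simpa [show 1 - γ - 1 = -γ by ring] using this
  have hG : ∫ u in Ioi (0:ℝ), (Real.exp (-u) * u ^ (-γ)) * L = Real.Gamma (1 - γ) * L := by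
    rw [integral_mul_const, Real.Gamma_eq_integral (by linarith)]
    simp [show 1 - γ - 1 = -γ by ring]
  rw [← hG]
  have key : ∀ s : ℝ, 0 < s → 
      ∫ u in Ioi (0:ℝ), (Real.exp (-u) * u ^ (-γ)) * ((s⁻¹ * u) ^ γ * Φ (s⁻¹ * u))
        = s ^ (1 - γ) * ∫ t in Ioi (0:ℝ), Real.exp (-s * t) * Φ t := by
    intro s hs
    have e1 := integral_comp_mul_left_Ioi (fun t => Real.exp (-s * t) * Φ t) 0 (inv_pos.2 hs)
    rw [mul_zero, smul_eq_mul, inv_inv] at e1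
    have hsg := (rpow_pos_of_pos hs γ).ne'
    rw [rpow_sub hs, rpow_one, div_mul_eq_mul_div, mul_div_right_comm, div_mul_eq_mul_div, ← e1, div_eq_inv_mul, 
      ← integral_const_mul]
    apply setIntegral_congr_fun measurableSet_Ioi
    intro u hu
    have hu : 0 < u := hu
    have hug := (rpow_pos_of_pos hu γ).ne'
    have e2 : -s * (s⁻¹ * u) = -u := by field_simp
    simp only
    rw [e2, mul_rpow (inv_pos.2 hs).le hu.le, rpow_neg hu.le, inv_rpow hs.le]
    field_simp
  have main : Tendsto (fun s : ℝ => ∫ u in Ioi (0:ℝ), 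
        (Real.exp (-u) * u ^ (-γ)) * ((s⁻¹ * u) ^ γ * Φ (s⁻¹ * u)))
      (nhdsWithin 0 (Ioi 0)) (nhds (∫ u in Ioi (0:ℝ), (Real.exp (-u) * u ^ (-γ)) * L)) := by
    apply tendsto_integral_filter_of_dominated_convergence 
      (fun u => (Real.exp (-u) * u ^ (-γ)) * M)
    · filter_upwards [self_mem_nhdsWithin] with s hs
      have hs : 0 < s⁻¹ := inv_pos.2 hs
      have ha : AntitoneOn (fun u => Φ (s⁻¹ * u)) (Ioi 0) := by
        intro a ha b hb hab
        exact hanti (mul_pos hs ha) (mul_pos hs hb) (mul_le_mul_of_nonneg_left hab hs.le)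
      have hm := aemeasurable_restrict_of_antitoneOn (μ := volume) measurableSet_Ioi ha
      refine AEStronglyMeasurable.mul hgi.1 (AEStronglyMeasurable.mul ?_ hm.aestronglyMeasurable)
      exact ((measurable_id.const_mul _).pow_const _).aestronglyMeasurable
    · filter_upwards [self_mem_nhdsWithin] with s hs
      have hs : 0 < s⁻¹ := inv_pos.2 hs
      rw [ae_restrict_iff' measurableSet_Ioi]
      refine Eventually.of_forall fun u hu => ?_
      have hu : 0 < u := hu
      have h0 : 0 ≤ Real.exp (-u) * u ^ (-γ) := by positivity
      rw [norm_mul, Real.norm_of_nonneg h0]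
      exact mul_le_mul_of_nonneg_left (hM _ (mul_pos hs hu)) h0
    · exact hgi.mul_const _
    · rw [ae_restrict_iff' measurableSet_Ioi]
      refine Eventually.of_forall fun u hu => ?_
      have hu : 0 < u := hu
      exact (h.comp (tendsto_inv_nhdsGT_zero.atTop_mul_const hu)).const_mul _
  refine main.congr' ?_
  filter_upwards [self_mem_nhdsWithin] with s hs using key s hs

lemma aux_psi (ψ : ℝ → ℝ) (hψ_int : IntegrableOn ψ (Set.Ioi 0)) :
    Tendsto (fun s : ℝ => ∫ t in Ioi (0:ℝ), Real.exp (-s * t) * ψ t)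
      (nhdsWithin 0 (Ioi 0)) (nhds (∫ t in Ioi (0:ℝ), ψ t)) := by
  apply tendsto_integral_filter_of_dominated_convergence (fun u => ‖ψ u‖)
  · refine Eventually.of_forall fun s => ?_
    refine AEStronglyMeasurable.mul ?_ hψ_int.1
    exact (by fun_prop : Continuous fun t : ℝ => Real.exp (-s * t)).aestronglyMeasurable
  · filter_upwards [self_mem_nhdsWithin] with s hs
    have hs : 0 < s := hs
    rw [ae_restrict_iff' measurableSet_Ioi]
    refine Eventually.of_forall fun u hu => ?_
    have hu : 0 < u := hu
    rw [norm_mul, Real.norm_of_nonneg (Real.exp_pos _).le]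
    refine mul_le_of_le_one_left (norm_nonneg _) ?_
    rw [Real.exp_le_one_iff]
    nlinarith [mul_pos hs hu]
  · exact hψ_int.norm
  · refine Eventually.of_forall fun u => ?_
    have : Continuous fun s : ℝ => Real.exp (-s * u) * ψ u := by fun_prop
    simpa using (this.tendsto 0).mono_left nhdsWithin_le_nhds


/-- if the waiting-time density ψ has heavy tail `t^{1+γ} ψ(t) → κ τ^γ`,
then with Φ its survival probability,
`lim_{s→0+} s^{γ−1} · L{ψ}(s)/L{Φ}(s) = γ/(κ Γ(1−γ) τ^γ)`. -/
theorem laplace_ratio_small_s_heavy_tail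
    (γ κ τ : ℝ) (hγ0 : 0 < γ) (hγ1 : γ < 1) (hκ : 0 < κ) (hτ : 0 < τ)
    (ψ Φ : ℝ → ℝ)
    (hψ_nonneg : ∀ t, 0 ≤ t → 0 ≤ ψ t)
    (hψ_int : IntegrableOn ψ (Set.Ioi 0))
    (hψ_norm : ∫ t in Set.Ioi (0 : ℝ), ψ t = 1)
    (hΦ : ∀ t, Φ t = ∫ t' in Set.Ioi t, ψ t')
    (htail : Tendsto (fun t : ℝ => t ^ (1 + γ) * ψ t) atTop (nhds (κ * τ ^ γ))) :
    Tendsto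
      (fun s : ℝ =>
        s ^ (γ - 1) *
          ((∫ t in Set.Ioi (0 : ℝ), Real.exp (-s * t) * ψ t) /
            (∫ t in Set.Ioi (0 : ℝ), Real.exp (-s * t) * Φ t)))
      (nhdsWithin 0 (Set.Ioi 0))
      (nhds (γ / (κ * Real.Gamma (1 - γ) * τ ^ γ))) := by
  have h1 := aux_tail γ _ hγ0 ψ Φ hψ_int hΦ htail
  have hle : ∀ a b : ℝ, 0 ≤ a → a ≤ b → Φ b ≤ Φ a := by
    intro a b ha hab
    rw [hΦ, hΦ]
    apply setIntegral_mono_set (hψ_int.mono_set (Ioi_subset_Ioi ha))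
    · rw [EventuallyLE, ae_restrict_iff' measurableSet_Ioi]
      exact Eventually.of_forall fun u hu => hψ_nonneg u (ha.trans (le_of_lt hu))
    · exact (Ioi_subset_Ioi hab).eventuallyLE
  have hanti : AntitoneOn Φ (Ioi 0) := fun a ha b _ hab => hle a b (le_of_lt ha) hab
  have hb : ∀ t, 0 < t → ‖Φ t‖ ≤ 1 := by
    intro t ht
    have h0 : 0 ≤ Φ t := by
      rw [hΦ]
      exact setIntegral_nonneg measurableSet_Ioi fun u hu => hψ_nonneg u (ht.le.trans (le_of_lt hu))
    rw [Real.norm_of_nonneg h0, ← hψ_norm, ← hΦ]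
    exact hle 0 t le_rfl ht.le
  have h2 := aux_lap γ _ hγ0 hγ1 Φ hanti hb h1
  have h3 := aux_psi ψ hψ_int
  rw [hψ_norm] at h3
  have hG : 0 < Real.Gamma (1 - γ) := Real.Gamma_pos_of_pos (by linarith)
  have hτγ : 0 < τ ^ γ := rpow_pos_of_pos hτ _
  have h4 := h3.div h2 (by positivity)
  have e : 1 / (Real.Gamma (1 - γ) * (κ * τ ^ γ / γ)) = γ / (κ * Real.Gamma (1 - γ) * τ ^ γ) := by
    field_simp
  rw [e] at h4
  refine h4.congr' ?_
  filter_upwards [self_mem_nhdsWithin] with s hs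
  have hs : 0 < s := hs
  simp only [Pi.div_apply]
  rw [show γ - 1 = -(1 - γ) by ring, rpow_neg hs.le, div_mul_eq_div_div_swap, div_eq_inv_mul]
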